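/- arXiv:2104.02675 — 2 statements merged into one kernel-verified Lean document; each statement's English description precedes it below -/
import Mathlib

section
/- Let (W,S) be a Coxeter system with nerve 𝒩(W,S) = {J ⊆ S : W_J is finite}. The map J ↦ w₀(J) is a bijection from 𝒩(W,S) to the set of 1-pop-stack-sortable elements Pop⁻¹(e) = {w ∈ W : Pop(w) = e}. In particular, if W is finite then |Pop⁻¹(e)| = 2^|S|. -/
namespace CoxPop

variable {B W : Type*} [Group W] {M : CoxeterMatrix B} (cs : CoxeterSystem M W)

/-- The standard parabolic subgroup generated by the simple reflections indexed by `J`. -/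
def parabolic (J : Set B) : Subgroup W :=
  Subgroup.closure (cs.simple '' J)

/-- The right descent set of `w`. -/
def D (w : W) : Set B := {i | cs.IsRightDescent w i}

/-- `u` is a longest element of the standard parabolic subgroup `W_J`. -/
def IsLongestIn (J : Set B) (u : W) : Prop :=
  u ∈ parabolic cs J ∧ ∀ v ∈ parabolic cs J, cs.length v ≤ cs.length u

open Classical in
/-- The longest element `w₀(J)` of the standard parabolic subgroup `W_J`. -/
noncomputable def w0 (J : Set B) : W :=
  if h : ∃ u, IsLongestIn cs J u then h.choose else 1

/-- The Coxeter pop-stack-sorting operator: `Pop w = w * w₀(D_R(w))`. -/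
noncomputable def Pop (w : W) : W := w * w0 cs (D cs w)

/-- The right weak order on `W`: `x ≤_R y` iff `ℓ(x) + ℓ(x⁻¹y) = ℓ(y)`. -/
def rweakLE (x y : W) : Prop := cs.length x + cs.length (x⁻¹ * y) = cs.length y

/-- `u` is the minimal-length representative `ᴶw` of the right coset `W_J w`. -/
def IsMinRep (J : Set B) (w u : W) : Prop :=
  (∃ p ∈ parabolic cs J, u = p * w) ∧
    ∀ v : W, (∃ p ∈ parabolic cs J, v = p * w) → cs.length u ≤ cs.length v

/-- A map `f : W → W` is compulsive if `f(w) ≤_R w` and `f(w) ≤_R ws` for every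
right descent `s` of `w`. -/
def Compulsive (f : W → W) : Prop :=
  ∀ w : W, rweakLE cs (f w) w ∧ ∀ i ∈ D cs w, rweakLE cs (f w) (w * cs.simple i)

/-- The strong Bruhat order: `x ≤ y` iff some reduced word for `y` contains a
reduced word for `x` as a (not necessarily contiguous) subword. -/
def bruhatLE (x y : W) : Prop :=
  ∃ ω : List B, cs.wordProd ω = y ∧ ω.length = cs.length y ∧
    ∃ ω' : List B, ω'.Sublist ω ∧ cs.wordProd ω' = x ∧ ω'.length = cs.length x

/-- The Coxeter system is irreducible: its Coxeter diagram is connected, i.e. the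
index set admits no nontrivial partition into two mutually commuting parts. -/
def Irreducible : Prop :=
  ∀ J : Set B, (∀ i ∈ J, ∀ j ∈ Jᶜ, M i j = 2) → J = ∅ ∨ J = Set.univ

end CoxPop

namespace Module
open Polynomial.Chebyshev

theorem reflection_mul_reflection_pow_eq_one {V : Type*} [AddCommGroup V] [Module ℝ V]
    {x y : V} {f g : Dual ℝ V} (hf : f x = 2) (hg : g y = 2) {m : ℕ} (hm : 2 ≤ m)
    (hfy : f y = -2 * Real.cos (Real.pi / m)) (hgx : g x = -2 * Real.cos (Real.pi / m)) :
    (reflection hf * reflection hg) ^ m = 1 := by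
  obtain rfl | hm3 := hm.eq_or_lt
  · have hfy' : f y = 0 := by simp [hfy]
    have hgx' : g x = 0 := by simp [hgx]
    ext z
    simp only [pow_two, LinearEquiv.mul_apply, reflection_apply, map_sub, map_smul, hf, hg, hfy',
      hgx', LinearEquiv.coe_one, id_eq]
    module
  · have hm0 : (m : ℝ) ≠ 0 := by positivity
    set θ : ℝ := 2 * Real.pi / m with hθ
    have hsin : Real.sin θ ≠ 0 := by
      refine (Real.sin_pos_of_pos_of_lt_pi (by positivity) ?_).ne'
      rw [hθ, div_lt_iff₀ (by positivity)]
      have : (3 : ℝ) ≤ m := by exact_mod_cast hm3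
      nlinarith [Real.pi_pos]
    have ht : 2 * Real.cos θ = f y * g x - 2 := by
      rw [hfy, hgx, hθ, mul_div_assoc, Real.cos_two_mul]; ring
    have hS (n : ℤ) : (S ℝ n).eval (2 * Real.cos θ) = Real.sin ((n + 1) * θ) / Real.sin θ := by
      rw [eq_div_iff hsin, S_two_mul_real_cos]
    ext z
    rw [reflection_mul_reflection_pow_apply hf hg m z _ ht]
    obtain ⟨k, rfl⟩ | ⟨k, rfl⟩ := m.even_or_odd
    · have h₁ : ((((k + k : ℕ) : ℤ) - 2) / 2) = (k : ℤ) - 1 := by lia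
      have h₂ : ((((k + k : ℕ) : ℤ) - 1) / 2) = (k : ℤ) - 1 := by lia
      have h₃ : (S ℝ ((k : ℤ) - 1)).eval (2 * Real.cos θ) = 0 := by
        have : (((k : ℤ) - 1 : ℤ) + 1 : ℝ) * θ = Real.pi := by
          have hk : (k : ℝ) ≠ 0 := by intro h; simp [h] at hm0
          rw [hθ]; push_cast; field_simp; ring
        rw [hS, this]; simp
      rw [h₁, h₂, h₃]; simp
    · have h₁ : ((((2 * k + 1 : ℕ) : ℤ) - 1) / 2) = (k : ℤ) := by lia
      have h₂ : ((((2 * k + 1 : ℕ) : ℤ) - 3) / 2) = (k : ℤ) - 1 := by lia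
      have h₃ : ((((2 * k + 1 : ℕ) : ℤ)) / 2) = (k : ℤ) := by lia
      have h₄ : ((((2 * k + 1 : ℕ) : ℤ) - 2) / 2) = (k : ℤ) - 1 := by lia
      have h₅ : (S ℝ (k : ℤ)).eval (2 * Real.cos θ) +
          (S ℝ ((k : ℤ) - 1)).eval (2 * Real.cos θ) = 0 := by
        have : (((k : ℤ) : ℝ) + 1) * θ = 2 * Real.pi - (((k : ℤ) - 1 : ℤ) + 1 : ℝ) * θ := by
          rw [hθ]; push_cast at hm0 ⊢; field_simp; ring
        rw [hS, hS, this, Real.sin_two_pi_sub]; ring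
      rw [h₁, h₂, h₃, h₄, h₅]; simp

end Module

namespace CoxeterSystem
variable {B W : Type*} [Group W] {M : CoxeterMatrix B} (cs : CoxeterSystem M W)

/-- The simple coroot of index `i` in the geometric representation of a Coxeter group. -/
noncomputable def simpleCoroot (M : CoxeterMatrix B) (i : B) : Module.Dual ℝ (B →₀ ℝ) :=
  Finsupp.linearCombination ℝ fun j ↦ -2 * Real.cos (Real.pi / M i j)

theorem simpleCoroot_single (M : CoxeterMatrix B) (i j : B) :
    simpleCoroot M i (Finsupp.single j 1) = -2 * Real.cos (Real.pi / M i j) := by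
  simp [simpleCoroot]

theorem simpleCoroot_single_self (M : CoxeterMatrix B) (i : B) :
    simpleCoroot M i (Finsupp.single i 1) = 2 := by
  simp [simpleCoroot_single]

theorem isLiftable_reflection_simpleCoroot (M : CoxeterMatrix B) :
    M.IsLiftable fun i ↦ Module.reflection (simpleCoroot_single_self M i) := by
  intro i j
  obtain rfl | hij := eq_or_ne i j
  · simp only [M.diagonal, pow_one, ← pow_two]
    ext1 z
    simp [pow_two, Module.involutive_reflection (simpleCoroot_single_self M i) z]
  · rcases Nat.eq_zero_or_pos (M i j) with h | h
    · simp [h]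
    · refine Module.reflection_mul_reflection_pow_eq_one _ _ ?_ (simpleCoroot_single M i j) ?_
      · have := M.off_diagonal i j hij
        lia
      · rw [simpleCoroot_single, M.symmetric]

theorem simple_injective : Function.Injective cs.simple := by
  intro i j hij
  by_contra hne
  have h := congrArg (fun w ↦ cs.lift ⟨_, isLiftable_reflection_simpleCoroot M⟩ w
    (Finsupp.single i 1) i) hij
  simp only [cs.lift_apply_simple (isLiftable_reflection_simpleCoroot M),
    Module.reflection_apply, simpleCoroot_single_self] at h
  norm_num [Finsupp.single_apply, Ne.symm hne] at h

open Classical in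
/-- The action of a simple reflection on pairs `(t, ε)`: conjugate `t`, and change the sign `ε`
if `t` is that simple reflection. -/
noncomputable def signedConj (i : B) : Function.End (W × ZMod 2) :=
  fun p ↦ (cs.simple i * p.1 * cs.simple i, p.2 + if p.1 = cs.simple i then 1 else 0)

open Classical in
theorem signedConj_mul_signedConj_pow_apply (i j : B) (k : ℕ) (t : W) (ε : ZMod 2) :
    ((cs.signedConj i * cs.signedConj j) ^ k) (t, ε) =
      ((cs.simple i * cs.simple j) ^ k * t * ((cs.simple i * cs.simple j) ^ k)⁻¹,
        ε + ∑ n ∈ Finset.range (2 * k),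
          if t = cs.simple j * (cs.simple i * cs.simple j) ^ n then 1 else 0) := by
  set r := cs.simple i * cs.simple j with hr
  have hconj (n : ℕ) : r ^ n * cs.simple j * r ^ n = cs.simple j := by
    induction n with
    | zero => simp
    | succ n ih =>
      have : r * cs.simple j * r = cs.simple j := by simp [hr, mul_assoc]
      calc r ^ (n + 1) * cs.simple j * r ^ (n + 1)
          = r ^ n * (r * cs.simple j * r) * r ^ n := by
            rw [pow_succ, mul_assoc _ _ (r ^ n * r), (Commute.self_pow r n).symm.eq]; group
        _ = cs.simple j := by rw [this, ih]
  induction k with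
  | zero => simp; rfl
  | succ k ih =>
    rw [pow_succ', show ∀ (a b : Function.End (W × ZMod 2)) p, (a * b) p = a (b p) from
      fun _ _ _ ↦ rfl, ih]
    have h₁ : r ^ k * t * (r ^ k)⁻¹ = cs.simple j ↔ t = cs.simple j * r ^ (2 * k) := by
      rw [mul_inv_eq_iff_eq_mul, ← eq_inv_mul_iff_mul_eq]
      nth_rw 1 [← hconj k]
      rw [two_mul, pow_add]
      simp [mul_assoc]
    have h₂ : cs.simple j * (r ^ k * t * (r ^ k)⁻¹) * cs.simple j = cs.simple i ↔
        t = cs.simple j * r ^ (2 * k + 1) := by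
      have : cs.simple j * (r ^ k * t * (r ^ k)⁻¹) * cs.simple j = cs.simple i ↔
          r ^ k * t * (r ^ k)⁻¹ = cs.simple j * r := by
        generalize r ^ k * t * (r ^ k)⁻¹ = u
        constructor
        · intro h
          rw [hr, ← h]; simp [mul_assoc]
        · rintro rfl
          simp [hr, mul_assoc]
      rw [this, mul_inv_eq_iff_eq_mul, ← eq_inv_mul_iff_mul_eq]
      nth_rw 1 [← hconj k]
      rw [show 2 * k + 1 = k + (1 + k) by ring, pow_add, pow_add, pow_one]
      simp [mul_assoc]
    rw [show 2 * (k + 1) = 2 * k + 1 + 1 by ring, Finset.sum_range_succ, Finset.sum_range_succ]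
    change cs.signedConj i (cs.signedConj j _) = _
    simp only [signedConj, h₁, h₂, Prod.mk.injEq]
    constructor
    · rw [pow_succ' r k]; simp [hr, mul_assoc]
    · ring

theorem isLiftable_signedConj : M.IsLiftable cs.signedConj := by
  classical
  intro i j
  funext ⟨t, ε⟩
  rw [signedConj_mul_signedConj_pow_apply, two_mul, Finset.sum_range_add]
  simp only [pow_add, simple_mul_simple_pow, one_mul, ← two_mul]
  simp [show (2 : ZMod 2) = 0 from rfl]
  rfl

open Classical in
theorem lift_signedConj_wordProd_apply (ω : List B) (t : W) (ε : ZMod 2) :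
    cs.lift ⟨_, cs.isLiftable_signedConj⟩ (cs.wordProd ω) (t, ε) =
      (cs.wordProd ω * t * (cs.wordProd ω)⁻¹, ε + (cs.rightInvSeq ω).count t) := by
  induction ω with
  | nil => simp; rfl
  | cons i ω ih =>
    rw [wordProd_cons, map_mul, show ∀ (a b : Function.End (W × ZMod 2)) p, (a * b) p = a (b p)
      from fun _ _ _ ↦ rfl, ih, cs.lift_apply_simple cs.isLiftable_signedConj]
    have h : cs.wordProd ω * t * (cs.wordProd ω)⁻¹ = cs.simple i ↔
        (cs.wordProd ω)⁻¹ * cs.simple i * cs.wordProd ω = t := by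
      rw [mul_inv_eq_iff_eq_mul, ← eq_inv_mul_iff_mul_eq, mul_assoc, eq_comm]
    simp only [signedConj, h, rightInvSeq, List.count_cons, beq_iff_eq, Prod.mk.injEq]
    constructor
    · simp [mul_assoc]
    · push_cast; ring

/-- The exchange property, in terms of the right inversion sequence. -/
theorem IsRightDescent.simple_mem_rightInvSeq {ω : List B} {i : B}
    (h : cs.IsRightDescent (cs.wordProd ω) i) : cs.simple i ∈ cs.rightInvSeq ω := by
  classical
  obtain ⟨ω', hω', heq⟩ := cs.exists_isReduced (cs.wordProd ω * cs.simple i)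
  have hprod : cs.wordProd (ω'.concat i) = cs.wordProd ω := by
    rw [wordProd_concat, ← heq, simple_mul_simple_cancel_right]
  have hred : cs.IsReduced (ω'.concat i) := by
    rw [IsReduced, hprod, ← cs.isRightDescent_iff.1 h, heq, hω'.eq]; simp
  have hcount : (cs.rightInvSeq (ω'.concat i)).count (cs.simple i) = 1 :=
    List.count_eq_one_of_mem hred.nodup_rightInvSeq (by rw [rightInvSeq_concat]; simp)
  have h₁ := cs.lift_signedConj_wordProd_apply ω (cs.simple i) 0
  rw [← hprod, lift_signedConj_wordProd_apply, hcount] at h₁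
  by_contra hmem
  rw [List.count_eq_zero_of_not_mem hmem] at h₁
  simp at h₁

/-- The exchange property. -/
theorem IsRightDescent.exists_eraseIdx {ω : List B} {i : B}
    (h : cs.IsRightDescent (cs.wordProd ω) i) :
    ∃ j < ω.length, cs.wordProd ω * cs.simple i = cs.wordProd (ω.eraseIdx j) := by
  obtain ⟨j, hj, hji⟩ := List.getElem_of_mem h.simple_mem_rightInvSeq
  refine ⟨j, by simpa using hj, ?_⟩
  rw [← wordProd_mul_getD_rightInvSeq, List.getD_eq_getElem _ _ hj, hji]

end CoxeterSystem

namespace CoxPop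

variable {B W : Type*} [Group W] {M : CoxeterMatrix B} (cs : CoxeterSystem M W)

theorem simple_mem_parabolic {J : Set B} {i : B} (hi : i ∈ J) : cs.simple i ∈ parabolic cs J :=
  Subgroup.subset_closure ⟨i, hi, rfl⟩

theorem wordProd_mem_parabolic {J : Set B} {ω : List B} (hω : ∀ i ∈ ω, i ∈ J) :
    cs.wordProd ω ∈ parabolic cs J :=
  Subgroup.list_prod_mem _ fun _ hx ↦ by
    obtain ⟨i, hi, rfl⟩ := List.mem_map.1 hx
    exact simple_mem_parabolic cs (hω i hi)

theorem exists_isReduced_of_mem_parabolic {J : Set B} {w : W} (hw : w ∈ parabolic cs J) :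
    ∃ ω : List B, (∀ i ∈ ω, i ∈ J) ∧ cs.IsReduced ω ∧ w = cs.wordProd ω := by
  have key (u : W) (i : B) (hi : i ∈ J)
      (hu : ∃ ω : List B, (∀ i ∈ ω, i ∈ J) ∧ cs.IsReduced ω ∧ u = cs.wordProd ω) :
      ∃ ω : List B, (∀ i ∈ ω, i ∈ J) ∧ cs.IsReduced ω ∧ u * cs.simple i = cs.wordProd ω := by
    obtain ⟨ω, hωJ, hω, rfl⟩ := hu
    by_cases hd : cs.IsRightDescent (cs.wordProd ω) i
    · obtain ⟨j, hj, hprod⟩ := hd.exists_eraseIdx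
      refine ⟨ω.eraseIdx j, fun k hk ↦ hωJ k (List.mem_of_mem_eraseIdx hk), ?_, hprod⟩
      have h := cs.isRightDescent_iff.1 hd
      have h' := List.length_eraseIdx_of_lt hj
      rw [hω.eq] at h
      rw [CoxeterSystem.IsReduced, ← hprod, h']
      lia
    · refine ⟨ω.concat i, ?_, ?_, (cs.wordProd_concat i ω).symm⟩
      · simpa [or_imp, forall_and] using ⟨hωJ, hi⟩
      · rw [CoxeterSystem.IsReduced, cs.wordProd_concat, cs.not_isRightDescent_iff.1 hd, hω.eq]
        simp
  induction hw using Subgroup.closure_induction_right with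
  | one => exact ⟨[], by simp, by simp [CoxeterSystem.IsReduced], by simp⟩
  | mul_right x hx y hy ih =>
    obtain ⟨i, hi, rfl⟩ := hy
    exact key _ i hi ih
  | mul_inv_cancel x hx y hy ih =>
    obtain ⟨i, hi, rfl⟩ := hy
    rw [cs.inv_simple]
    exact key _ i hi ih

theorem simple_mem_parabolic_iff {J : Set B} {i : B} :
    cs.simple i ∈ parabolic cs J ↔ i ∈ J := by
  refine ⟨fun h ↦ ?_, simple_mem_parabolic cs⟩
  obtain ⟨ω, hωJ, hω, heq⟩ := exists_isReduced_of_mem_parabolic cs h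
  have hlen := hω.eq
  rw [← heq, cs.length_simple] at hlen
  obtain ⟨j, rfl⟩ := List.length_eq_one_iff.1 hlen.symm
  rw [cs.wordProd_singleton] at heq
  rw [cs.simple_injective heq]
  exact hωJ j (by simp)

theorem length_mul_add_length_of_subset_D {J : Set B} {u x : W} (hJ : J ⊆ D cs u)
    (hx : x ∈ parabolic cs J) : cs.length (u * x) + cs.length x = cs.length u := by
  obtain ⟨ω, hωJ, hω, rfl⟩ := exists_isReduced_of_mem_parabolic cs hx
  clear hx
  induction ω with
  | nil => simp
  | cons i ω ih =>
    have hω' : cs.IsReduced ω := by simpa using hω.drop 1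
    have ih := ih (fun k hk ↦ hωJ k (by simp [hk])) hω'
    obtain ⟨α, hα, hα'⟩ := cs.exists_isReduced (u * cs.wordProd ω)
    have hu : u = cs.wordProd (α ++ ω.reverse) := by
      rw [cs.wordProd_append, ← hα', cs.wordProd_reverse, mul_inv_cancel_right]
    have hi : cs.IsRightDescent u i := hJ (hωJ i (by simp))
    rw [hu] at hi
    obtain ⟨j, hj, hprod⟩ := hi.exists_eraseIdx
    rw [← hu] at hprod
    have hlower := cs.length_le_length_mul_add_right u (cs.wordProd (i :: ω))
    suffices cs.length (u * cs.wordProd (i :: ω)) + cs.length (cs.wordProd (i :: ω)) ≤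
        cs.length u by lia
    have hα_len : cs.length (u * cs.wordProd ω) = α.length := by rw [hα', hα.eq]
    have hω_len := hω.eq
    rw [List.length_cons] at hω_len
    rcases lt_or_ge j α.length with hjα | hjα
    · have h : u * cs.wordProd (i :: ω) = cs.wordProd (α.eraseIdx j) := by
        rw [cs.wordProd_cons, ← mul_assoc, hprod, List.eraseIdx_append_of_lt_length hjα,
          cs.wordProd_append, cs.wordProd_reverse, inv_mul_cancel_right]
      have hle := cs.length_wordProd_le (α.eraseIdx j)
      rw [← h, List.length_eraseIdx_of_lt hjα] at hle
      rw [hα_len, hω'.eq] at ih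
      lia
    · have hj' : j - α.length < ω.reverse.length := by rw [List.length_append] at hj; lia
      have h : (cs.wordProd (i :: ω))⁻¹ = cs.wordProd (ω.reverse.eraseIdx (j - α.length)) := by
        rw [List.eraseIdx_append_of_length_le hjα, cs.wordProd_append, ← hα', mul_assoc,
          mul_left_cancel_iff] at hprod
        rw [cs.wordProd_cons, mul_inv_rev, cs.inv_simple, hprod, inv_mul_cancel_left]
      have hle := cs.length_wordProd_le (ω.reverse.eraseIdx (j - α.length))
      rw [← h, cs.length_inv, List.length_eraseIdx_of_lt hj', List.length_reverse] at hle
      lia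

theorem isLongestIn_of_subset_D {J : Set B} {u : W} (hu : u ∈ parabolic cs J) (hJ : J ⊆ D cs u) :
    IsLongestIn cs J u := by
  refine ⟨hu, fun v hv ↦ ?_⟩
  have := length_mul_add_length_of_subset_D cs hJ (mul_mem (inv_mem hu) hv)
  rw [mul_inv_cancel_left] at this
  lia

variable {cs}

theorem IsLongestIn.subset_D {J : Set B} {u : W} (hu : IsLongestIn cs J u) : J ⊆ D cs u :=
  fun i hi ↦ lt_of_le_of_ne (hu.2 _ (mul_mem hu.1 (simple_mem_parabolic cs hi)))
    (cs.length_mul_simple_ne u i)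

theorem IsLongestIn.D_eq {J : Set B} {u : W} (hu : IsLongestIn cs J u) : D cs u = J := by
  refine Set.Subset.antisymm (fun i hi ↦ ?_) hu.subset_D
  obtain ⟨ω, hωJ, -, rfl⟩ := exists_isReduced_of_mem_parabolic cs hu.1
  obtain ⟨j, -, hprod⟩ := CoxeterSystem.IsRightDescent.exists_eraseIdx cs hi
  rw [← simple_mem_parabolic_iff cs, ← Subgroup.mul_mem_cancel_left _ hu.1, hprod]
  exact wordProd_mem_parabolic cs fun k hk ↦ hωJ k (List.mem_of_mem_eraseIdx hk)

theorem IsLongestIn.unique {J : Set B} {u v : W} (hu : IsLongestIn cs J u)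
    (hv : IsLongestIn cs J v) : u = v := by
  have h := length_mul_add_length_of_subset_D cs hu.subset_D (mul_mem (inv_mem hu.1) hv.1)
  rw [mul_inv_cancel_left] at h
  have h' := hv.2 u hu.1
  rw [← inv_mul_eq_one, ← cs.length_eq_zero_iff]
  lia

theorem IsLongestIn.inv {J : Set B} {u : W} (hu : IsLongestIn cs J u) : IsLongestIn cs J u⁻¹ :=
  ⟨inv_mem hu.1, fun v hv ↦ by simpa using hu.2 v hv⟩

theorem IsLongestIn.w0_eq {J : Set B} {u : W} (hu : IsLongestIn cs J u) : w0 cs J = u := by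
  have h : ∃ u, IsLongestIn cs J u := ⟨u, hu⟩
  rw [w0, dif_pos h]
  exact h.choose_spec.unique hu

theorem IsLongestIn.finite {J : Set B} {u : W} (hu : IsLongestIn cs J u) :
    (parabolic cs J : Set W).Finite := by
  have hJ : J.Finite := by
    obtain ⟨ω, -, rfl⟩ := cs.exists_isReduced u
    refine Set.Finite.of_finite_image (f := cs.simple)
      ((cs.rightInvSeq ω).finite_toSet.subset ?_) cs.simple_injective.injOn
    rintro _ ⟨i, hi, rfl⟩
    exact CoxeterSystem.IsRightDescent.simple_mem_rightInvSeq cs (hu.subset_D hi)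
  have := hJ.to_subtype
  refine ((List.finite_length_le J (cs.length u)).image
    fun ω ↦ cs.wordProd (ω.map Subtype.val)).subset fun v hv ↦ ?_
  obtain ⟨ω, hωJ, hω, rfl⟩ := exists_isReduced_of_mem_parabolic cs hv
  lift ω to List J using hωJ
  have hle := hu.2 _ hv
  rw [hω.eq, List.length_map] at hle
  exact ⟨ω, hle, rfl⟩

variable (cs)

theorem isLongestIn_w0 {J : Set B} (hJ : (parabolic cs J : Set W).Finite) :
    IsLongestIn cs J (w0 cs J) := by
  obtain ⟨u, hu, hmax⟩ := hJ.exists_maximalFor cs.length _ ⟨1, one_mem _⟩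
  have hu : IsLongestIn cs J u := ⟨hu, fun v hv ↦ (le_total _ _).elim id (hmax hv)⟩
  rwa [hu.w0_eq]

theorem isLongestIn_D_of_pop_eq_one {w : W} (hw : Pop cs w = 1) :
    IsLongestIn cs (D cs w) w := by
  have hw' : w = (w0 cs (D cs w))⁻¹ := eq_inv_of_mul_eq_one_left hw
  by_cases h : ∃ u, IsLongestIn cs (D cs w) u
  · obtain ⟨u, hu⟩ := h
    rw [hu.w0_eq] at hw'
    rw [hw'] at hu ⊢
    simpa using hu.inv
  · rw [w0, dif_neg h, inv_one] at hw'
    refine isLongestIn_of_subset_D cs ?_ subset_rfl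
    rw [hw']
    exact one_mem _

/-- `J ↦ w₀(J)` is a bijection from the nerve
`{J ⊆ S : W_J finite}` to the set of `1`-pop-stack-sortable elements; in
particular if `W` is finite there are exactly `2^|S|` such elements. -/
theorem nerve_bijOn_popPreimageOne :
    Set.BijOn (fun J => w0 cs J) {J : Set B | (parabolic cs J : Set W).Finite}
      {w : W | Pop cs w = 1} ∧
    (Finite W → Nat.card {w : W | Pop cs w = 1} = 2 ^ Nat.card B) := by
  have hbij : Set.BijOn (fun J => w0 cs J) {J : Set B | (parabolic cs J : Set W).Finite}
      {w : W | Pop cs w = 1} := by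
    refine ⟨fun J hJ ↦ ?_, fun J hJ K hK hJK ↦ ?_, fun w hw ↦ ?_⟩
    · have h := isLongestIn_w0 cs hJ
      rw [Set.mem_ofPred_eq, Pop, h.D_eq, mul_eq_one_iff_eq_inv]
      exact h.unique h.inv
    · rw [← (isLongestIn_w0 cs hJ).D_eq, ← (isLongestIn_w0 cs hK).D_eq]
      exact congrArg (D cs) hJK
    · have h := isLongestIn_D_of_pop_eq_one cs hw
      exact ⟨D cs w, h.finite, h.w0_eq⟩
  refine ⟨hbij, fun _ ↦ ?_⟩
  have : Finite B := Finite.of_injective _ cs.simple_injective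
  rw [← Nat.card_congr hbij.equiv]
  have := Fintype.ofFinite B
  simp [Set.toFinite, Nat.card_eq_fintype_card]

end CoxPop
end

section
/- For the symmetric group S_n with the Coxeter pop-stack-sorting operator Pop, every permutation w ∈ S_n satisfies Pop^{n−1}(w) = e (the identity), and there exists a permutation v ∈ S_n with Pop^{n−2}(v) ≠ e when n ≥ 2. -/
/-!
Statement 0: In a Coxeter group `W`, an element `w` is fixed by the Coxeter
pop-stack-sorting operator `Pop` (where `Pop w = w * w₀(D_R(w))`, with
`w₀(D_R(w))` the longest element of the standard parabolic subgroup generated by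
the right descent set of `w`) if and only if `w` is the identity.
-/

namespace CoxPop

variable {B W : Type*} [Group W] {M : CoxeterMatrix B} (cs : CoxeterSystem M W)

open Equiv

section Runs

/-- Positions `a` and `b` lie in the same maximal descending run of the one-line notation
of `σ`. -/
def SameRun (σ : Perm ℕ) (a b : ℕ) : Prop :=
  ∀ i, (a ≤ i ∧ i < b) ∨ (b ≤ i ∧ i < a) → σ (i + 1) < σ i

lemma SameRun.refl (σ : Perm ℕ) (a : ℕ) : SameRun σ a a := fun i hi => by omega

lemma SameRun.symm {σ : Perm ℕ} {a b : ℕ} (h : SameRun σ a b) : SameRun σ b a :=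
  fun i hi => h i hi.symm

lemma SameRun.trans {σ : Perm ℕ} {a b c : ℕ} (h : SameRun σ a b) (h' : SameRun σ b c) :
    SameRun σ a c := by
  intro i hi
  by_cases hb : (a ≤ i ∧ i < b) ∨ (b ≤ i ∧ i < a)
  · exact h i hb
  · exact h' i (by omega)

lemma SameRun.of_between {σ : Perm ℕ} {a b c : ℕ} (h : SameRun σ a b) (hac : a ≤ c)
    (hcb : c ≤ b) : SameRun σ a c :=
  fun i hi => h i (by omega)

/-- If `f` decreases at each step inside a run of `σ`, it is decreasing along that run. -/
lemma SameRun.lt_of_forall_lt {σ : Perm ℕ} {f : ℕ → ℕ}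
    (hf : ∀ i, σ (i + 1) < σ i → f (i + 1) < f i) {a b : ℕ} (h : SameRun σ a b) (hab : a < b) :
    f b < f a := by
  induction b, hab using Nat.le_induction with
  | base => exact hf a (h a (by omega))
  | succ b hb ih =>
    exact (hf b (h b (by omega))).trans (ih (h.of_between (by omega) (by omega)))

/-- `τ` is obtained from `σ` by permuting positions within each descending run of `σ`, so that
the entries of each run become increasing. -/
structure IsRunSort (σ τ : Perm ℕ) : Prop where
  sameRun : ∀ a, SameRun σ a (σ⁻¹ (τ a))
  lt : ∀ a b, SameRun σ a b → a < b → τ a < τ b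

/-- The positions before `p` whose entry is less than `k`. -/
def smallPositions (k : ℕ) (σ : Perm ℕ) (p : ℕ) : Finset ℕ :=
  (Finset.range p).filter fun a => σ a < k

@[simp] lemma mem_smallPositions {k : ℕ} {σ : Perm ℕ} {p a : ℕ} :
    a ∈ smallPositions k σ p ↔ a < p ∧ σ a < k := by
  simp [smallPositions]

lemma smallPositions_succ_of_le {k : ℕ} {σ : Perm ℕ} {p : ℕ} (h : k ≤ σ p) :
    smallPositions k σ (p + 1) = smallPositions k σ p := by
  ext a
  simp only [mem_smallPositions]
  constructor
  · rintro ⟨h1, h2⟩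
    refine ⟨?_, h2⟩
    rcases Nat.lt_succ_iff_lt_or_eq.1 h1 with h3 | rfl
    · exact h3
    · omega
  · rintro ⟨h1, h2⟩
    exact ⟨by omega, h2⟩

lemma card_smallPositions_succ_of_lt {k : ℕ} {σ : Perm ℕ} {p : ℕ} (h : σ p < k) :
    (smallPositions k σ (p + 1)).card = (smallPositions k σ p).card + 1 := by
  have : smallPositions k σ (p + 1) = insert p (smallPositions k σ p) := by
    ext a
    simp only [mem_smallPositions, Finset.mem_insert]
    constructor
    · rintro ⟨h1, h2⟩
      by_cases h3 : a = p
      · exact Or.inl h3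
      · exact Or.inr ⟨by omega, h2⟩
    · rintro (rfl | ⟨h1, h2⟩)
      · exact ⟨by omega, h⟩
      · exact ⟨by omega, h2⟩
  rw [this, Finset.card_insert_of_notMem (by simp)]

lemma IsRunSort.exists_injOn {σ τ : Perm ℕ} (h : IsRunSort σ τ) (k p : ℕ) :
    ∃ f : ℕ → ℕ, Set.InjOn f (smallPositions k σ p) ∧
      (∀ a ∈ smallPositions k σ p, f a ∈ smallPositions k τ p) ∧
      (∀ q, p = q + 1 → k ≤ σ q → σ p < k →
        ∃ x ∈ smallPositions k τ p, ∀ a ∈ smallPositions k σ p, f a ≠ x) := by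
  classical
  have hτ : ∀ a, τ (τ⁻¹ (σ a)) = σ a := fun a => by simp
  have hrun : ∀ a, SameRun σ a (τ⁻¹ (σ a)) := fun a => by
    simpa using (h.sameRun (τ⁻¹ (σ a))).symm
  have hinj : Function.Injective fun a => τ⁻¹ (σ a) :=
    τ⁻¹.injective.comp σ.injective
  by_cases hA : ∀ a < p, SameRun σ a p → τ a < k
  · refine ⟨fun a => if SameRun σ a p then a else τ⁻¹ (σ a), ?_, ?_, ?_⟩
    · intro a _ b _ hab
      simp only at hab
      split_ifs at hab with h1 h2 h2
      · exact hab
      · exact absurd ((hrun b).trans (hab ▸ h1)) h2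
      · exact absurd ((hrun a).trans (hab ▸ h2)) h1
      · exact hinj hab
    · intro a ha
      rw [mem_smallPositions] at ha
      simp only
      split_ifs with h1
      · exact mem_smallPositions.2 ⟨ha.1, hA a ha.1 h1⟩
      · refine mem_smallPositions.2 ⟨?_, by rw [hτ]; exact ha.2⟩
        by_contra hge
        exact h1 ((hrun a).of_between ha.1.le (not_lt.1 hge))
    · intro q hq hkq hkp
      have hqp : SameRun σ q p := fun i hi => by
        have : i = q := by omega
        subst this
        rw [← hq]
        omega
      refine ⟨q, mem_smallPositions.2 ⟨by omega, hA q (by omega) hqp⟩, ?_⟩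
      intro a ha
      rw [mem_smallPositions] at ha
      simp only
      split_ifs with h1
      · rintro rfl
        omega
      · intro hne
        exact h1 ((hrun a).trans (hne ▸ hqp))
  · push Not at hA
    obtain ⟨c, hcp, hc, hck⟩ := hA
    have hlt : ∀ a, σ a < k → SameRun σ a p → τ⁻¹ (σ a) < p := by
      intro a ha hap
      by_contra hge
      have := h.lt c (τ⁻¹ (σ a)) (hc.trans (hap.symm.trans (hrun a))) (by omega)
      rw [hτ] at this
      omega
    refine ⟨fun a => τ⁻¹ (σ a), hinj.injOn, ?_, ?_⟩
    · intro a ha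
      rw [mem_smallPositions] at ha
      refine mem_smallPositions.2 ⟨?_, by rw [hτ]; exact ha.2⟩
      by_contra hge
      exact hge (hlt a ha.2 ((hrun a).of_between ha.1.le (not_lt.1 hge)))
    · intro q _ _ hkp
      refine ⟨τ⁻¹ (σ p), mem_smallPositions.2 ⟨hlt p hkp (SameRun.refl σ p), by rwa [hτ]⟩, ?_⟩
      intro a ha hne
      rw [mem_smallPositions] at ha
      have := hinj hne
      omega

lemma IsRunSort.card_smallPositions_le {σ τ : Perm ℕ} (h : IsRunSort σ τ) (k p : ℕ) :
    (smallPositions k σ p).card ≤ (smallPositions k τ p).card := by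
  obtain ⟨f, hf, hm, -⟩ := h.exists_injOn k p
  exact Finset.card_le_card_of_injOn f hm hf

lemma IsRunSort.card_smallPositions_lt {σ τ : Perm ℕ} (h : IsRunSort σ τ) {k q : ℕ}
    (hq : k ≤ σ q) (hq' : σ (q + 1) < k) :
    (smallPositions k σ (q + 1)).card < (smallPositions k τ (q + 1)).card := by
  obtain ⟨f, hf, hm, hx⟩ := h.exists_injOn k (q + 1)
  obtain ⟨x, hxm, hx⟩ := hx q rfl hq hq'
  refine lt_of_le_of_lt (b := ((smallPositions k τ (q + 1)).erase x).card) ?_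
    (Finset.card_erase_lt_of_mem hxm)
  exact Finset.card_le_card_of_injOn f (fun a ha => Finset.mem_erase.2 ⟨hx a ha, hm a ha⟩) hf

lemma card_smallPositions_of_le {n k p : ℕ} {σ : Perm ℕ} (hσ : ∀ a, n ≤ a → σ a = a)
    (hk : k ≤ n) (hp : n ≤ p) : (smallPositions k σ p).card = k := by
  have : smallPositions k σ p = (Finset.range k).map σ⁻¹.toEmbedding := by
    ext a
    simp only [mem_smallPositions, Finset.mem_map_equiv, Finset.mem_range]
    constructor
    · exact fun h => h.2
    · intro h
      refine ⟨?_, h⟩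
      by_contra hpa
      have h1 := hσ a (by omega)
      have h2 : σ a < k := h
      omega
  rw [this, Finset.card_map, Finset.card_range]

lemma le_card_smallPositions_add {n k p : ℕ} {σ : Perm ℕ} (hσ : ∀ a, n ≤ a → σ a = a)
    (hp : p ≤ n) : p ≤ (smallPositions k σ p).card + (n - k) := by
  have hlt : ∀ a < n, σ a < n := by
    intro a ha
    by_contra hn
    have := σ.injective (hσ (σ a) (by omega))
    omega
  have h1 := Finset.card_filter_add_card_filter_not (s := Finset.range p) (fun a => σ a < k)
  have h2 : ((Finset.range p).filter fun a => ¬ σ a < k).card ≤ (Finset.Ico k n).card := by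
    refine Finset.card_le_card_of_injOn σ (fun a ha => ?_) σ.injective.injOn
    simp only [Finset.coe_filter, Finset.mem_range, Set.mem_ofPred_eq] at ha
    simp only [Finset.coe_Ico, Set.mem_Ico]
    exact ⟨by omega, hlt a (by omega)⟩
  rw [Finset.card_range] at h1
  rw [Nat.card_Ico] at h2
  simp only [smallPositions]
  omega

lemma eq_one_of_apply_le {σ : Perm ℕ} (h : ∀ a, σ a ≤ a) : σ = 1 := by
  ext a
  induction a using Nat.strong_induction_on with
  | _ a ih =>
    rcases (h a).lt_or_eq with hlt | heq
    · have := σ.injective (ih _ hlt)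
      rw [Perm.coe_one, id] at *
      omega
    · simpa using heq

/-- After `T` rounds of run sorting, the `j`-th entry less than `k` is among the first `p`
positions as soon as `p ≥ max j (n - k + 2 * j - 1 - T)`. -/
lemma le_card_smallPositions_of_isRunSort {n : ℕ} {σ : ℕ → Perm ℕ}
    (hσ : ∀ T a, n ≤ a → σ T a = a) (hs : ∀ T, IsRunSort (σ T) (σ (T + 1))) {k : ℕ} (hk : k ≤ n)
    (T j p : ℕ) (hjk : j ≤ k) (hjp : j ≤ p) (hp : n + 2 * j ≤ p + T + 1 + k) :
    j ≤ (smallPositions k (σ T) p).card := by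
  induction T generalizing j p with
  | zero =>
    rcases le_total n p with hnp | hpn
    · rwa [card_smallPositions_of_le (hσ 0) hk hnp]
    · have := le_card_smallPositions_add (k := k) (hσ 0) hpn
      omega
  | succ T ih =>
    rcases le_total n p with hnp | hpn
    · rwa [card_smallPositions_of_le (hσ _) hk hnp]
    rcases Nat.eq_zero_or_pos j with rfl | hj
    · exact Nat.zero_le _
    obtain ⟨q, rfl⟩ : ∃ q, p = q + 1 := ⟨p - 1, by omega⟩
    have hmono := (hs T).card_smallPositions_le k (q + 1)
    have hprev := ih (j - 1) q (by omega) (by omega) (by omega)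
    have hnext := ih j (q + 1 + 1) hjk (by omega) (by omega)
    by_cases hq : k ≤ σ T q
    · by_cases hq' : σ T (q + 1) < k
      · have := (hs T).card_smallPositions_lt hq hq'
        rw [smallPositions_succ_of_le hq] at this
        omega
      · rw [smallPositions_succ_of_le (not_lt.1 hq')] at hnext
        omega
    · have := card_smallPositions_succ_of_lt (not_le.1 hq)
      omega

/-- Ungar's bound: `n - 1` rounds of run sorting sort every permutation of `n` letters. -/
theorem eq_one_of_isRunSort {n : ℕ} {σ : ℕ → Perm ℕ} (hn : 1 ≤ n)
    (hσ : ∀ T a, n ≤ a → σ T a = a) (hs : ∀ T, IsRunSort (σ T) (σ (T + 1))) :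
    σ (n - 1) = 1 := by
  refine eq_one_of_apply_le fun a => ?_
  rcases le_or_gt n a with hna | han
  · exact (hσ _ a hna).le
  have h := le_card_smallPositions_of_isRunSort hσ hs (k := a + 1) han (n - 1) (a + 1) (a + 1)
    le_rfl le_rfl (by omega)
  have hfilter : smallPositions (a + 1) (σ (n - 1)) (a + 1) = Finset.range (a + 1) :=
    Finset.eq_of_subset_of_card_le (Finset.filter_subset _ _) (by simpa using h)
  have : a ∈ smallPositions (a + 1) (σ (n - 1)) (a + 1) := by simp [hfilter]
  exact Nat.lt_succ_iff.1 (mem_smallPositions.1 this).2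

end Runs

section TypeA

variable {W : Type*} [Group W] {m : ℕ}

lemma swap_succ_braid (i : ℕ) :
    swap i (i + 1) * swap (i + 1) (i + 2) * swap i (i + 1) =
      swap (i + 1) (i + 2) * swap i (i + 1) * swap (i + 1) (i + 2) := by
  have h1 : swap (i + 1) i * swap (i + 2) (i + 1) * swap (i + 1) i = swap i (i + 2) :=
    swap_mul_swap_mul_swap (by simp) (by simp)
  have h2 : swap (i + 1) (i + 2) * swap i (i + 1) * swap (i + 1) (i + 2) = swap (i + 2) i :=
    swap_mul_swap_mul_swap (by simp) (by simp)
  rw [h2, swap_comm (i + 2) i, ← h1, swap_comm (i + 1) i, swap_comm (i + 2) (i + 1)]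

lemma mul_pow_three_of_braid {G : Type*} [Group G] {a b : G} (ha : a * a = 1) (hb : b * b = 1)
    (h : a * b * a = b * a * b) : (a * b) ^ 3 = 1 := by
  calc (a * b) ^ 3 = (a * b * a) * (b * a * b) := by simp only [pow_three, mul_assoc]
    _ = (b * a * b) * (b * a * b) := by rw [h]
    _ = b * a * (b * b) * a * b := by simp only [mul_assoc]
    _ = b * (a * a) * b := by rw [hb]; simp only [mul_assoc, one_mul]
    _ = 1 := by rw [ha, mul_one, hb]

lemma isLiftable_swap_succ (m : ℕ) :
    (CoxeterMatrix.A m).IsLiftable fun i : Fin m => swap (i : ℕ) (i + 1) := by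
  intro i j
  obtain ⟨i, hi⟩ := i
  obtain ⟨j, hj⟩ := j
  simp only [CoxeterMatrix.A, Matrix.of_apply, Fin.mk.injEq]
  split_ifs with h1 h2
  · subst h1
    simp
  · rcases h2 with rfl | rfl
    · exact mul_pow_three_of_braid (swap_mul_self _ _) (swap_mul_self _ _)
        (swap_succ_braid j).symm
    · exact mul_pow_three_of_braid (swap_mul_self _ _) (swap_mul_self _ _) (swap_succ_braid i)
  · have hd : Perm.Disjoint (swap i (i + 1)) (swap j (j + 1)) := by
      intro a
      by_cases ha : a = i ∨ a = i + 1
      · right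
        exact swap_apply_of_ne_of_ne (by omega) (by omega)
      · left
        exact swap_apply_of_ne_of_ne (by omega) (by omega)
    rw [hd.commute.mul_pow]
    simp [pow_two]

variable (cs : CoxeterSystem (CoxeterMatrix.A m) W)

/-- The action of the Coxeter group of type `A m` on `ℕ`, in which the `i`-th simple reflection
exchanges `i` and `i + 1`. -/
def toPerm : W →* Perm ℕ := cs.lift ⟨_, isLiftable_swap_succ m⟩

@[simp] lemma toPerm_simple (i : Fin m) : toPerm cs (cs.simple i) = swap (i : ℕ) (i + 1) :=
  cs.lift_apply_simple _ i

lemma toPerm_apply_of_lt (w : W) {a : ℕ} (ha : m < a) : toPerm cs w a = a := by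
  induction w using cs.simple_induction_left with
  | one => simp
  | mul_simple_left w i ih =>
    rw [map_mul, Perm.mul_apply, ih, toPerm_simple]
    exact swap_apply_of_ne_of_ne (by omega) (by omega)

/-- The simple reflections of type `A m`, indexed by all natural numbers; those with index at
least `m` are `1`. -/
def natSimple (i : ℕ) : W := if h : i < m then cs.simple ⟨i, h⟩ else 1

lemma natSimple_of_lt {i : ℕ} (h : i < m) : natSimple cs i = cs.simple ⟨i, h⟩ := dif_pos h

lemma natSimple_mul_self (i : ℕ) : natSimple cs i * natSimple cs i = 1 := by
  unfold natSimple
  split_ifs <;> simp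

lemma toPerm_natSimple {i : ℕ} (h : i < m) : toPerm cs (natSimple cs i) = swap i (i + 1) := by
  rw [natSimple_of_lt cs h, toPerm_simple]

lemma natSimple_comm {i j : ℕ} (h : i + 1 < j) :
    natSimple cs i * natSimple cs j = natSimple cs j * natSimple cs i := by
  by_cases hj : j < m
  · have hi : i < m := by omega
    rw [natSimple_of_lt cs hi, natSimple_of_lt cs hj]
    have hM : CoxeterMatrix.A m ⟨i, hi⟩ ⟨j, hj⟩ = 2 := by
      change (if _ then _ else _) = 2
      rw [if_neg (by simp only [Fin.mk.injEq]; omega), if_neg (by simp only; omega)]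
    have h2 := cs.simple_mul_simple_pow ⟨i, hi⟩ ⟨j, hj⟩
    rw [hM, pow_two] at h2
    simpa using eq_inv_of_mul_eq_one_left h2
  · simp [natSimple, hj]

lemma natSimple_braid {i : ℕ} (h : i + 1 < m) :
    natSimple cs (i + 1) * natSimple cs i * natSimple cs (i + 1) =
      natSimple cs i * natSimple cs (i + 1) * natSimple cs i := by
  have hi : i < m := by omega
  rw [natSimple_of_lt cs hi, natSimple_of_lt cs h]
  have hM : CoxeterMatrix.A m ⟨i, hi⟩ ⟨i + 1, h⟩ = 3 := by
    change (if _ then _ else _) = 3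
    rw [if_neg (by simp only [Fin.mk.injEq]; omega), if_pos (Or.inr rfl)]
  have h3 := cs.simple_mul_simple_pow ⟨i, hi⟩ ⟨i + 1, h⟩
  rw [hM] at h3
  have h4 : (cs.simple ⟨i, hi⟩ * cs.simple ⟨i + 1, h⟩ * cs.simple ⟨i, hi⟩) *
      (cs.simple ⟨i + 1, h⟩ * cs.simple ⟨i, hi⟩ * cs.simple ⟨i + 1, h⟩) = 1 := by
    rw [← h3]
    simp only [pow_three, mul_assoc]
  have h5 := eq_inv_of_mul_eq_one_left h4
  simp only [mul_inv_rev, CoxeterSystem.inv_simple] at h5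
  rw [h5, mul_assoc]

/-- The product of the `d` simple reflections with indices `k + d - 1, …, k + 1, k`. -/
def descProd : ℕ → ℕ → W
  | _, 0 => 1
  | k, d + 1 => descProd (k + 1) d * natSimple cs k

lemma descProd_mul_of_lt {k i : ℕ} (d : ℕ) (h : i + 1 < k) :
    descProd cs k d * natSimple cs i = natSimple cs i * descProd cs k d := by
  induction d generalizing k with
  | zero => simp [descProd]
  | succ d ih =>
    rw [descProd, mul_assoc, ← natSimple_comm cs h, ← mul_assoc, ih (by omega), mul_assoc]

lemma descProd_mul_succ {k i d : ℕ} (hki : k ≤ i) (hid : i + 1 < k + d) (hd : k + d ≤ m) :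
    descProd cs k d * natSimple cs (i + 1) = natSimple cs i * descProd cs k d := by
  induction d generalizing k with
  | zero => omega
  | succ d ih =>
    rcases hki.eq_or_lt with rfl | hlt
    · obtain ⟨e, rfl⟩ : ∃ e, d = e + 1 := ⟨d - 1, by omega⟩
      simp only [descProd]
      calc descProd cs (k + 1 + 1) e * natSimple cs (k + 1) * natSimple cs k * natSimple cs (k + 1)
          = descProd cs (k + 1 + 1) e *
              (natSimple cs (k + 1) * natSimple cs k * natSimple cs (k + 1)) := by
            simp only [mul_assoc]
        _ = (descProd cs (k + 1 + 1) e * natSimple cs k) * natSimple cs (k + 1) *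
              natSimple cs k := by
            rw [natSimple_braid cs (by omega)]
            simp only [mul_assoc]
        _ = _ := by
            rw [descProd_mul_of_lt cs e (by omega)]
            simp only [mul_assoc]
    · rw [descProd, mul_assoc, natSimple_comm cs (by omega), ← mul_assoc,
        ih hlt (by omega) (by omega), mul_assoc]

lemma toPerm_descProd_apply {k d : ℕ} (hd : k + d ≤ m) :
    toPerm cs (descProd cs k d) k = k + d := by
  induction d generalizing k with
  | zero => simp [descProd]
  | succ d ih =>
    rw [descProd, map_mul, Perm.mul_apply, toPerm_natSimple cs (by omega), swap_apply_left,
      ih (by omega)]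
    omega

/-- The submonoid generated by the simple reflections with index less than `j`. -/
def initialParabolic (j : ℕ) : Submonoid W :=
  Submonoid.closure (natSimple cs '' Set.Iio j)

lemma natSimple_mem_initialParabolic {i j : ℕ} (h : i < j) :
    natSimple cs i ∈ initialParabolic cs j :=
  Submonoid.subset_closure ⟨i, h, rfl⟩

lemma initialParabolic_zero : initialParabolic cs 0 = ⊥ := by
  simp [initialParabolic]

lemma initialParabolic_eq_top : initialParabolic cs m = ⊤ := by
  rw [eq_top_iff, ← cs.submonoid_closure_range_simple]
  refine Submonoid.closure_mono ?_
  rintro _ ⟨i, rfl⟩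
  exact ⟨i, i.2, natSimple_of_lt cs i.2⟩

lemma toPerm_apply_of_mem_initialParabolic {j a : ℕ} (hjm : j ≤ m) (ha : j < a) {w : W}
    (hw : w ∈ initialParabolic cs j) : toPerm cs w a = a := by
  induction hw using Submonoid.closure_induction with
  | mem x hx =>
    obtain ⟨i, hi, rfl⟩ := hx
    have hi' : i < j := hi
    rw [toPerm_natSimple cs (by omega)]
    exact swap_apply_of_ne_of_ne (by omega) (by omega)
  | one => simp
  | mul x y _ _ hx hy => rw [map_mul, Perm.mul_apply, hy, hx]

/-- The elements `descProd cs k d` with `k + d = j + 1` represent the cosets of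
`initialParabolic cs j` in `initialParabolic cs (j + 1)`. -/
lemma exists_mul_descProd {j : ℕ} (hjm : j + 1 ≤ m) {w : W}
    (hw : w ∈ initialParabolic cs (j + 1)) :
    ∃ h ∈ initialParabolic cs j, ∃ k d, k + d = j + 1 ∧ w = h * descProd cs k d := by
  induction hw using Submonoid.closure_induction_right with
  | one => exact ⟨1, one_mem _, j + 1, 0, rfl, by simp [descProd]⟩
  | mul_right x _ y hy ih =>
    obtain ⟨i, hi, rfl⟩ := hy
    have hi' : i < j + 1 := hi
    obtain ⟨h, hh, k, d, hkd, rfl⟩ := ih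
    rcases lt_trichotomy i k with hik | rfl | hik
    · rcases (Nat.succ_le_of_lt hik).eq_or_lt with rfl | hik'
      · exact ⟨h, hh, i, d + 1, by omega, by rw [descProd, mul_assoc]⟩
      · exact ⟨h * natSimple cs i, mul_mem hh (natSimple_mem_initialParabolic cs (by omega)),
          k, d, hkd, by rw [mul_assoc, descProd_mul_of_lt cs d hik', mul_assoc]⟩
    · obtain ⟨e, rfl⟩ : ∃ e, d = e + 1 := ⟨d - 1, by omega⟩
      exact ⟨h, hh, i + 1, e, by omega,
        by rw [descProd, mul_assoc, mul_assoc, natSimple_mul_self, mul_one]⟩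
    · obtain ⟨i, rfl⟩ : ∃ e, i = e + 1 := ⟨i - 1, by omega⟩
      exact ⟨h * natSimple cs i, mul_mem hh (natSimple_mem_initialParabolic cs (by omega)),
          k, d, hkd, by
            rw [mul_assoc, descProd_mul_succ cs (by omega) (by omega) (by omega), mul_assoc]⟩

theorem toPerm_injective : Function.Injective (toPerm cs) := by
  rw [injective_iff_map_eq_one]
  intro w hw
  have key : ∀ j ≤ m, w ∈ initialParabolic cs j → w = 1 := by
    intro j
    induction j with
    | zero =>
      intro _ h
      rwa [initialParabolic_zero, Submonoid.mem_bot] at h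
    | succ j ih =>
      intro hj hmem
      obtain ⟨h, hh, k, d, hkd, rfl⟩ := exists_mul_descProd cs hj hmem
      have h1 : toPerm cs (h * descProd cs k d) k = j + 1 := by
        rw [map_mul, Perm.mul_apply, toPerm_descProd_apply cs (by omega), hkd]
        exact toPerm_apply_of_mem_initialParabolic cs (by omega) (by omega) hh
      rw [hw, Perm.one_apply] at h1
      obtain rfl : d = 0 := by omega
      refine ih (by omega) ?_
      simpa [descProd] using hh
  exact key m le_rfl (by rw [initialParabolic_eq_top]; trivial)

lemma finite_of_typeA {W : Type*} [Group W] (cs : CoxeterSystem (CoxeterMatrix.A m) W) :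
    Finite W := by
  have hlt : ∀ (w : W) (a : Fin (m + 1)), toPerm cs w a < m + 1 := by
    intro w a
    by_contra hge
    have := (toPerm cs w).injective (toPerm_apply_of_lt cs w (a := toPerm cs w a) (by omega))
    omega
  refine Finite.of_injective
    (fun w => fun a : Fin (m + 1) => (⟨toPerm cs w a, hlt w a⟩ : Fin (m + 1))) ?_
  intro v w hvw
  refine toPerm_injective cs (Equiv.ext fun a => ?_)
  rcases lt_or_ge m a with ha | ha
  · rw [toPerm_apply_of_lt cs v ha, toPerm_apply_of_lt cs w ha]
  · exact congrArg Fin.val (congrFun hvw ⟨a, by omega⟩)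

/-- The exchange property for a word whose action has a descent at position `i`. -/
lemma length_wordProd_mul_simple_lt (ω : List (Fin m)) (i : Fin m)
    (h : toPerm cs (cs.wordProd ω) (i + 1) < toPerm cs (cs.wordProd ω) i) :
    cs.length (cs.wordProd ω * cs.simple i) < ω.length := by
  induction ω with
  | nil => simp at h
  | cons j ω ih =>
    rw [cs.wordProd_cons] at h ⊢
    set v := cs.wordProd ω with hv
    rw [map_mul, Perm.mul_apply, Perm.mul_apply, toPerm_simple] at h
    by_cases hd : toPerm cs v (i + 1) < toPerm cs v i
    · have h1 := cs.length_mul_le (cs.simple j) (v * cs.simple i)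
      rw [cs.length_simple, ← mul_assoc] at h1
      have := ih hd
      simp only [List.length_cons]
      omega
    · have hne : toPerm cs v i ≠ toPerm cs v (i + 1) := fun he => by
        have := (toPerm cs v).injective he
        omega
      have hj : toPerm cs v i = j ∧ toPerm cs v (i + 1) = j + 1 := by
        simp only [swap_apply_def] at h
        split_ifs at h <;> omega
      have he : cs.simple j * v = v * cs.simple i := by
        apply toPerm_injective cs
        rw [map_mul, map_mul, toPerm_simple, toPerm_simple, mul_swap_eq_swap_mul, hj.1, hj.2]
      rw [he, cs.simple_mul_simple_cancel_right]
      exact Nat.lt_succ_of_le (cs.length_wordProd_le ω)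

lemma isRightDescent_of_toPerm_lt {w : W} {i : Fin m} (h : toPerm cs w (i + 1) < toPerm cs w i) :
    cs.IsRightDescent w i := by
  obtain ⟨ω, hω, rfl⟩ := cs.exists_isReduced w
  rw [CoxeterSystem.IsRightDescent, hω.eq]
  exact length_wordProd_mul_simple_lt cs ω i h

theorem isRightDescent_iff_toPerm_lt {w : W} {i : Fin m} :
    cs.IsRightDescent w i ↔ toPerm cs w (i + 1) < toPerm cs w i := by
  refine ⟨fun h => ?_, isRightDescent_of_toPerm_lt cs⟩
  by_contra hge
  have hne : toPerm cs w (i + 1) ≠ toPerm cs w i := fun he => by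
    have := (toPerm cs w).injective he
    omega
  rw [cs.isRightDescent_iff_not_isRightDescent_mul] at h
  refine h (isRightDescent_of_toPerm_lt cs ?_)
  simp only [map_mul, Perm.mul_apply, toPerm_simple, swap_apply_left, swap_apply_right]
  omega

lemma isLongestIn_w0_s9 (J : Set (Fin m)) : IsLongestIn cs J (w0 cs J) := by
  have := finite_of_typeA cs
  have hex : ∃ u, IsLongestIn cs J u := by
    obtain ⟨u, hu, hmax⟩ := Set.exists_max_image (parabolic cs J : Set W) cs.length
      (Set.toFinite _) ⟨1, one_mem _⟩
    exact ⟨u, hu, hmax⟩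
  rw [w0, dif_pos hex]
  exact hex.choose_spec

lemma IsLongestIn.isRightDescent {B W : Type*} [Group W] {M : CoxeterMatrix B}
    {cs : CoxeterSystem M W} {J : Set B} {u : W} (hu : IsLongestIn cs J u) {i : B} (hi : i ∈ J) :
    cs.IsRightDescent u i := by
  have h1 := hu.2 (u * cs.simple i) (mul_mem hu.1 (Subgroup.subset_closure ⟨i, hi, rfl⟩))
  exact lt_of_le_of_ne h1 (cs.length_mul_simple_ne u i)

lemma sameRun_of_mem_parabolic (w : W) {v : W} (hv : v ∈ parabolic cs (D cs w)) (a : ℕ) :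
    SameRun (toPerm cs w) a (toPerm cs v a) := by
  induction hv using Subgroup.closure_induction generalizing a with
  | mem x hx =>
    obtain ⟨i, hi, rfl⟩ := hx
    have hd : toPerm cs w (i + 1) < toPerm cs w i := (isRightDescent_iff_toPerm_lt cs).1 hi
    rw [toPerm_simple]
    intro c hc
    obtain rfl : c = i := by
      rw [swap_apply_def] at hc
      split_ifs at hc <;> omega
    exact hd
  | one => simpa using SameRun.refl _ a
  | mul x y _ _ hx hy =>
    rw [map_mul, Perm.mul_apply]
    exact (hy a).trans (hx _)
  | inv x _ hx =>
    rw [map_inv]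
    simpa using (hx ((toPerm cs x)⁻¹ a)).symm

theorem isRunSort_toPerm_Pop (w : W) : IsRunSort (toPerm cs w) (toPerm cs (Pop cs w)) := by
  have hu := isLongestIn_w0_s9 cs (D cs w)
  have hrun := sameRun_of_mem_parabolic cs w hu.1
  rw [Pop, map_mul]
  refine ⟨fun a => by simpa using hrun a, fun a b hab hlt => ?_⟩
  rw [Perm.mul_apply, Perm.mul_apply]
  have h1 : toPerm cs (w0 cs (D cs w)) b < toPerm cs (w0 cs (D cs w)) a := by
    refine hab.lt_of_forall_lt (fun i hi => ?_) hlt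
    have him : i < m := by
      by_contra hge
      have h1 := toPerm_apply_of_lt cs w (a := i + 1) (by omega)
      have h2 := toPerm_apply_of_lt cs w (a := toPerm cs w i) (by omega)
      have := (toPerm cs w).injective h2
      omega
    exact (isRightDescent_iff_toPerm_lt cs).1
      (hu.isRightDescent ((isRightDescent_iff_toPerm_lt cs (i := ⟨i, him⟩)).2 hi))
  exact ((hrun b).symm.trans (hab.symm.trans (hrun a))).lt_of_forall_lt (fun _ hi => hi) h1

lemma w0_singleton (i : Fin m) : w0 cs {i} = cs.simple i := by
  have hu := isLongestIn_w0_s9 cs {i}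
  have hne : w0 cs {i} ≠ 1 := fun h1 =>
    cs.not_isRightDescent_one i (h1 ▸ hu.isRightDescent (Set.mem_singleton i))
  have hmem := hu.1
  rw [parabolic, Set.image_singleton, Subgroup.mem_closure_singleton] at hmem
  obtain ⟨z, hz⟩ := hmem
  rcases Int.even_or_odd' z with ⟨c, rfl | rfl⟩
  · rw [zpow_mul, zpow_ofNat, cs.simple_sq, one_zpow] at hz
    exact absurd hz.symm hne
  · rw [zpow_add, zpow_mul, zpow_ofNat, cs.simple_sq, one_zpow, one_mul, zpow_one] at hz
    exact hz.symm

/-- The product `s₀ s₁ ⋯ s_{r-1}`. -/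
def ascProd : ℕ → W
  | 0 => 1
  | r + 1 => ascProd r * natSimple cs r

lemma toPerm_ascProd_apply {r : ℕ} (hr : r ≤ m) (a : ℕ) :
    toPerm cs (ascProd cs r) a = if a < r then a + 1 else if a = r then 0 else a := by
  induction r generalizing a with
  | zero =>
    simp only [ascProd, map_one, Perm.one_apply]
    split_ifs <;> omega
  | succ r ih =>
    rw [ascProd, map_mul, Perm.mul_apply, toPerm_natSimple cs (by omega), ih (by omega),
      swap_apply_def]
    split_ifs <;> omega

lemma Pop_ascProd_succ {r : ℕ} (hr : r < m) : Pop cs (ascProd cs (r + 1)) = ascProd cs r := by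
  have hD : D cs (ascProd cs (r + 1)) = {⟨r, hr⟩} := by
    ext i
    rw [Set.mem_singleton_iff, Fin.ext_iff]
    change cs.IsRightDescent _ _ ↔ _
    rw [isRightDescent_iff_toPerm_lt, toPerm_ascProd_apply cs (by omega),
      toPerm_ascProd_apply cs (by omega)]
    split_ifs <;> simp only <;> omega
  rw [Pop, hD, w0_singleton, ascProd, natSimple_of_lt cs hr, cs.simple_mul_simple_cancel_right]

lemma iterate_Pop_ascProd {r t : ℕ} (h : r + t ≤ m) :
    (Pop cs)^[t] (ascProd cs (r + t)) = ascProd cs r := by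
  induction t with
  | zero => rfl
  | succ t ih =>
    rw [Function.iterate_succ_apply, ← Nat.add_assoc, Pop_ascProd_succ cs (by omega),
      ih (by omega)]

theorem iterate_Pop_eq_one (w : W) : (Pop cs)^[m] w = 1 := by
  apply toPerm_injective cs
  rw [map_one]
  refine eq_one_of_isRunSort (n := m + 1) (σ := fun T => toPerm cs ((Pop cs)^[T] w)) (by omega)
    (fun T a ha => toPerm_apply_of_lt cs _ ha) fun T => ?_
  simp only [Function.iterate_succ_apply']
  exact isRunSort_toPerm_Pop cs _

theorem exists_iterate_Pop_ne_one (hm : 1 ≤ m) : ∃ v : W, (Pop cs)^[m - 1] v ≠ 1 := by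
  refine ⟨ascProd cs (1 + (m - 1)), fun h => ?_⟩
  rw [iterate_Pop_ascProd cs (by omega)] at h
  have h0 := toPerm_ascProd_apply cs hm 0
  simp [h] at h0

end TypeA

/-- Ungar's theorem: for the symmetric group `Sₙ`, realized as the
Coxeter group of type `A_{n-1}`, every element `w` satisfies `Pop^[n-1] w = e`, and if
`n ≥ 2` some element `v` satisfies `Pop^[n-2] v ≠ e`. -/
theorem symmetric_group_pop_orbit {W : Type*} [Group W] (n : ℕ) (hn : 1 ≤ n)
    (cs : CoxeterSystem (CoxeterMatrix.Aₙ (n - 1)) W) :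
    (∀ w : W, (Pop cs)^[n - 1] w = 1) ∧
      (2 ≤ n → ∃ v : W, (Pop cs)^[n - 2] v ≠ 1) := by
  exact ⟨iterate_Pop_eq_one cs, fun h => exists_iterate_Pop_ne_one cs (by omega)⟩

end CoxPop
end
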